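/- arXiv:quant-ph/0203077 — 3 statements merged into one kernel-verified Lean document; each statement's English description precedes it below -/
import Mathlib

section
/- Let d ≥ 2 be an integer and X a finite set with |X| = d². Let W be a probability distribution on X and let 0 ≤ R < 1 − H(W), where H(V) = −Σ_{x∈X} V(x) log_d V(x). Then the infimum over all probability distributions V on X of D(V‖W) + max(1 − H(V) − R, 0) is strictly positive, where D(V‖W) = Σ_{x∈X} V(x) log_d (V(x)/W(x)) if V is absolutely continuous with respect to W and D(V‖W) = +∞ otherwise. -/
/-!
STATEMENT 8: positivity of the random coding exponent
`E_r(R,W) = inf_V [D(V‖W) + |1 − H(V) − R|⁺]` for `0 ≤ R < 1 − H(W)`,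
with entropy and divergence taken base `d` and `D(V‖W) = +∞` when `V ⋪ W`.
-/

open scoped BigOperators Classical

/-- Base-`d` entropy of a distribution on `X`. -/
noncomputable def entD (d : ℕ) {X : Type*} [Fintype X] (P : X → ℝ) : ℝ :=
  -∑ x, P x * Real.logb d (P x)

/-- Base-`d` information divergence, valued in `EReal`, equal to `+∞` when `V` is
not absolutely continuous with respect to `W`. -/
noncomputable def divD (d : ℕ) {X : Type*} [Fintype X] (V W : X → ℝ) : EReal :=
  if ∀ x, W x = 0 → V x = 0 then
    ((∑ x, V x * Real.logb d (V x / W x) : ℝ) : EReal)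
  else ⊤

open InformationTheory in
theorem sum_mul_log_div_eq_sum_klFun {X : Type*} [Fintype X] {V W : X → ℝ}
    (hVW : ∀ x, W x = 0 → V x = 0) (hsum : ∑ x, V x = ∑ x, W x) :
    ∑ x, V x * Real.log (V x / W x) = ∑ x, W x * klFun (V x / W x) := by
  have h : ∀ x, W x * klFun (V x / W x) = V x * Real.log (V x / W x) + (W x - V x) := by
    intro x
    by_cases hx : W x = 0
    · simp [hx, hVW x hx]
    · rw [klFun]
      field_simp
      ring
  simp only [h, Finset.sum_add_distrib, Finset.sum_sub_distrib, hsum, sub_self, add_zero]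

theorem sum_mul_log_div_nonneg {X : Type*} [Fintype X] {V W : X → ℝ}
    (hV : ∀ x, 0 ≤ V x) (hW : ∀ x, 0 ≤ W x)
    (hVW : ∀ x, W x = 0 → V x = 0) (hsum : ∑ x, V x = ∑ x, W x) :
    0 ≤ ∑ x, V x * Real.log (V x / W x) := by
  rw [sum_mul_log_div_eq_sum_klFun hVW hsum]
  exact Finset.sum_nonneg fun x _ => mul_nonneg (hW x)
    (InformationTheory.klFun_nonneg (div_nonneg (hV x) (hW x)))

theorem eq_of_sum_mul_log_div_eq_zero {X : Type*} [Fintype X] {V W : X → ℝ}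
    (hV : ∀ x, 0 ≤ V x) (hW : ∀ x, 0 ≤ W x)
    (hVW : ∀ x, W x = 0 → V x = 0) (hsum : ∑ x, V x = ∑ x, W x)
    (h : ∑ x, V x * Real.log (V x / W x) = 0) : V = W := by
  rw [sum_mul_log_div_eq_sum_klFun hVW hsum, Finset.sum_eq_zero_iff_of_nonneg fun x _ =>
    mul_nonneg (hW x) (InformationTheory.klFun_nonneg (div_nonneg (hV x) (hW x)))] at h
  funext x
  by_cases hx : W x = 0
  · rw [hx, hVW x hx]
  · have hk := (mul_eq_zero.mp (h x (Finset.mem_univ x))).resolve_left hx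
    rwa [InformationTheory.klFun_eq_zero_iff (div_nonneg (hV x) (hW x)),
      div_eq_one_iff_eq hx] at hk

theorem sum_mul_logb_div {X : Type*} [Fintype X] (b : ℝ) (V W : X → ℝ) :
    ∑ x, V x * Real.logb b (V x / W x) =
      (∑ x, V x * Real.log (V x / W x)) / Real.log b := by
  simp only [Real.logb, Finset.sum_div, mul_div_assoc]

theorem continuous_mul_log_div (w : ℝ) :
    Continuous fun t : ℝ => t * Real.log (t / w) := by
  by_cases hw : w = 0
  · simpa [hw] using continuous_const
  · have h : (fun t : ℝ => t * Real.log (t / w)) =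
        fun t => w * (t / w * Real.log (t / w)) := by
      funext t
      field_simp
    rw [h]
    exact continuous_const.mul (Real.continuous_mul_log.comp (continuous_id.div_const w))

theorem continuous_sum_mul_logb_div {X : Type*} [Fintype X] (b : ℝ) (W : X → ℝ) :
    Continuous fun V : X → ℝ => ∑ x, V x * Real.logb b (V x / W x) := by
  simp only [sum_mul_logb_div]
  exact (continuous_finsetSum _ fun x _ =>
    (continuous_mul_log_div (W x)).comp (continuous_apply x)).div_const _

theorem continuous_entD (d : ℕ) {X : Type*} [Fintype X] :
    Continuous fun V : X → ℝ => entD d V := by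
  have h := continuous_sum_mul_logb_div (d : ℝ) (fun _ : X => (1 : ℝ))
  simp only [div_one] at h
  exact h.neg

theorem isCompact_stdSimplex_absolutelyContinuous {X : Type*} [Fintype X] (W : X → ℝ) :
    IsCompact (stdSimplex ℝ X ∩ {V : X → ℝ | ∀ x, W x = 0 → V x = 0}) := by
  refine (isCompact_stdSimplex ℝ X).inter_right ?_
  simp only [Set.ofPred_forall]
  exact isClosed_iInter fun x => isClosed_iInter fun _ =>
    isClosed_eq (continuous_apply x) continuous_const

theorem random_coding_exponent_positive (d : ℕ) (hd : 2 ≤ d)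
    (X : Type) [Fintype X] (hX : Fintype.card X = d ^ 2)
    (W : X → ℝ) (hW0 : ∀ x, 0 ≤ W x) (hW1 : ∑ x, W x = 1)
    (R : ℝ) (hR0 : 0 ≤ R) (hR1 : R < 1 - entD d W) :
    (0 : EReal) <
      sInf {v : EReal | ∃ V : X → ℝ,
        (∀ x, 0 ≤ V x) ∧ (∑ x, V x) = 1 ∧
        v = divD d V W + ((max (1 - entD d V - R) 0 : ℝ) : EReal)} := by
  have hlog : 0 < Real.log d := Real.log_pos (by exact_mod_cast hd)
  obtain ⟨U, ⟨⟨hU0, hU1⟩, hUW⟩, hmin⟩ :=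
    (isCompact_stdSimplex_absolutelyContinuous W).exists_isMinOn
      ⟨W, ⟨hW0, hW1⟩, fun _ h => h⟩
      ((continuous_sum_mul_logb_div (d : ℝ) W).add
        (((continuous_const.sub (continuous_entD d)).sub continuous_const).max
          continuous_const : Continuous fun V : X → ℝ => max (1 - entD d V - R) 0)).continuousOn
  have hpos : 0 < ∑ x, U x * Real.logb d (U x / W x) + max (1 - entD d U - R) 0 := by
    rw [sum_mul_logb_div]
    have hsum : ∑ x, U x = ∑ x, W x := hU1.trans hW1.symm
    rcases (sum_mul_log_div_nonneg hU0 hW0 hUW hsum).eq_or_lt with h | h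
    · obtain rfl := eq_of_sum_mul_log_div_eq_zero hU0 hW0 hUW hsum h.symm
      rw [← h, zero_div, zero_add]
      exact lt_max_of_lt_left (by linarith)
    · exact add_pos_of_pos_of_nonneg (div_pos h hlog) (le_max_right _ _)
  refine (EReal.coe_pos.mpr hpos).trans_le (le_sInf ?_)
  rintro v ⟨V, hV0, hV1, rfl⟩
  by_cases hVW : ∀ x, W x = 0 → V x = 0
  · rw [divD, if_pos hVW, ← EReal.coe_add]
    exact EReal.coe_le_coe_iff.mpr (hmin ⟨⟨hV0, hV1⟩, hVW⟩)
  · rw [divD, if_neg hVW, EReal.top_add_coe]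
    exact le_top
end

section
/- Let d ≥ 2 be an integer and X a finite set with |X| = d², and let W be a probability distribution on X. Then for every R ≥ 0, the minimum over probability distributions V on X of [D(V‖W) + max(1 − H(V) − R, 0)] equals the maximum over ρ ∈ [0,1] of [−ρR + ρ − (1+ρ) log_d Σ_{x∈X} W(x)^{1/(1+ρ)}], where H(V) = −Σ V(x) log_d V(x) and D(V‖W) = Σ V(x) log_d(V(x)/W(x)) (interpreted as +∞ when V is not absolutely continuous with respect to W). -/
/-!
STATEMENT 9: Gallager form of the random coding exponent:
`min_V [D(V‖W) + |1 − H(V) − R|⁺] = max_{0≤ρ≤1} [−ρR + E₀(ρ,W)]`,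
where `E₀(ρ,W) = ρ − (1+ρ) log_d ∑_x W(x)^{1/(1+ρ)}`.
-/

open scoped BigOperators Classical

/-- Gallager's function `E₀(ρ,W) = ρ − (1+ρ) log_d ∑_x W(x)^{1/(1+ρ)}`. -/
noncomputable def E₀ (d : ℕ) {X : Type*} [Fintype X] (ρ : ℝ) (W : X → ℝ) : ℝ :=
  ρ - (1 + ρ) * Real.logb d (∑ x, W x ^ (1 / (1 + ρ)))

/-- The Gibbs inequality for a distribution `V` against an unnormalized weight `w`. -/
theorem neg_logb_sum_le_sum_mul_logb_div {X : Type*} [Fintype X] {b : ℝ} (hb : 1 < b)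
    {V w : X → ℝ} (hV0 : ∀ x, 0 ≤ V x) (hV1 : ∑ x, V x = 1) (hw0 : ∀ x, 0 ≤ w x)
    (hVw : ∀ x, w x = 0 → V x = 0) (hZ : 0 < ∑ x, w x) :
    -Real.logb b (∑ x, w x) ≤ ∑ x, V x * Real.logb b (V x / w x) := by
  set Z := ∑ x, w x with hZdef
  have hpt : ∀ x, V x - w x / Z ≤ V x * Real.log (V x / w x) + V x * Real.log Z := by
    intro x
    rcases (hV0 x).eq_or_lt with h | h
    · simpa [← h] using div_nonneg (hw0 x) hZ.le
    · have hw : 0 < w x := (hw0 x).lt_of_ne fun h' => h.ne' (hVw x h'.symm)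
      have hlog := Real.log_le_sub_one_of_pos (div_pos hw (mul_pos h hZ))
      rw [Real.log_div hw.ne' (mul_pos h hZ).ne', Real.log_mul h.ne' hZ.ne'] at hlog
      rw [Real.log_div h.ne' hw.ne']
      have hmul := mul_le_mul_of_nonneg_left hlog h.le
      have heq : V x * (w x / (V x * Z) - 1) = w x / Z - V x := by
        field_simp
      rw [heq] at hmul
      linarith
  have hsum := Finset.sum_le_sum fun x (_ : x ∈ Finset.univ) => hpt x
  rw [Finset.sum_sub_distrib, Finset.sum_add_distrib, ← Finset.sum_mul, ← Finset.sum_div, hV1,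
    ← hZdef, div_self hZ.ne'] at hsum
  have hlb : 0 < Real.log b := Real.log_pos hb
  simp only [Real.logb, ← mul_div_assoc, ← Finset.sum_div]
  rw [← neg_div]
  gcongr
  linarith

/-- The divergence minus `ρ` times the entropy is a scaled divergence from the tilted weight. -/
theorem sum_mul_logb_div_sub_mul_entD (d : ℕ) {X : Type*} [Fintype X] {V W : X → ℝ}
    (hV0 : ∀ x, 0 ≤ V x) (hW0 : ∀ x, 0 ≤ W x) (hVW : ∀ x, W x = 0 → V x = 0)
    {ρ : ℝ} (hρ : 0 ≤ ρ) :
    ∑ x, V x * Real.logb d (V x / W x) - ρ * entD d V =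
      (1 + ρ) * ∑ x, V x * Real.logb d (V x / W x ^ (1 / (1 + ρ))) := by
  rw [entD, mul_neg, sub_neg_eq_add, Finset.mul_sum, Finset.mul_sum, ← Finset.sum_add_distrib]
  refine Finset.sum_congr rfl fun x _ => ?_
  rcases (hV0 x).eq_or_lt with h | h
  · simp [← h]
  · have hw : 0 < W x := (hW0 x).lt_of_ne fun h' => h.ne' (hVW x h'.symm)
    have h1 : 1 + ρ ≠ 0 := by positivity
    rw [Real.logb_div h.ne' hw.ne', Real.logb_div h.ne' (Real.rpow_pos_of_pos hw _).ne',
      Real.logb_rpow_eq_mul_logb_of_pos hw]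
    field_simp
    ring

/-- The distribution proportional to `W ^ (1 / (1 + ρ))`. -/
noncomputable def tiltedDist {X : Type*} [Fintype X] (W : X → ℝ) (ρ : ℝ) (x : X) : ℝ :=
  W x ^ (1 / (1 + ρ)) / ∑ y, W y ^ (1 / (1 + ρ))

section TiltedDist

variable {X : Type*} [Fintype X] {W : X → ℝ} {ρ : ℝ}

theorem sum_rpow_pos (hW0 : ∀ x, 0 ≤ W x) (hW1 : ∑ x, W x = 1) (s : ℝ) :
    0 < ∑ x, W x ^ s := by
  obtain ⟨x, -, hx⟩ := Finset.exists_ne_zero_of_sum_ne_zero (hW1.trans_ne one_ne_zero)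
  exact Finset.sum_pos' (fun y _ => Real.rpow_nonneg (hW0 y) _)
    ⟨x, Finset.mem_univ x, Real.rpow_pos_of_pos ((hW0 x).lt_of_ne' hx) _⟩

theorem tiltedDist_nonneg (hW0 : ∀ x, 0 ≤ W x) (x : X) : 0 ≤ tiltedDist W ρ x :=
  div_nonneg (Real.rpow_nonneg (hW0 x) _)
    (Finset.sum_nonneg fun y _ => Real.rpow_nonneg (hW0 y) _)

theorem sum_tiltedDist (hW0 : ∀ x, 0 ≤ W x) (hW1 : ∑ x, W x = 1) :
    ∑ x, tiltedDist W ρ x = 1 := by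
  simp only [tiltedDist, ← Finset.sum_div]
  exact div_self (sum_rpow_pos hW0 hW1 _).ne'

theorem tiltedDist_eq_zero (hρ : 0 ≤ ρ) {x : X} (hx : W x = 0) : tiltedDist W ρ x = 0 := by
  have : 1 / (1 + ρ) ≠ 0 := by positivity
  rw [tiltedDist, hx, Real.zero_rpow this, zero_div]

theorem sum_tiltedDist_mul_logb_div (d : ℕ) (hW0 : ∀ x, 0 ≤ W x) (hW1 : ∑ x, W x = 1)
    (hρ : 0 ≤ ρ) :
    ∑ x, tiltedDist W ρ x * Real.logb d (tiltedDist W ρ x / W x ^ (1 / (1 + ρ))) =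
      -Real.logb d (∑ x, W x ^ (1 / (1 + ρ))) := by
  rw [← one_mul (-Real.logb _ _)]
  refine Eq.trans ?_ (congrArg (· * _) (sum_tiltedDist (ρ := ρ) hW0 hW1))
  simp only [Finset.sum_mul]
  refine Finset.sum_congr rfl fun x _ => ?_
  rcases (hW0 x).eq_or_lt with h | h
  · simp [tiltedDist_eq_zero hρ h.symm]
  · have hw := (Real.rpow_pos_of_pos h (1 / (1 + ρ))).ne'
    congr 1
    rw [← Real.logb_inv]
    congr 1
    rw [tiltedDist, div_right_comm, div_self hw, one_div]

theorem continuousOn_entD_tiltedDist (d : ℕ) (hW0 : ∀ x, 0 ≤ W x) (hW1 : ∑ x, W x = 1) :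
    ContinuousOn (fun ρ => entD d (tiltedDist W ρ)) (Set.Ici 0) := by
  have hpow : ∀ x, ContinuousOn (fun ρ : ℝ => W x ^ (1 / (1 + ρ))) (Set.Ici 0) := by
    intro x ρ hρ
    have hρ' : 0 ≤ ρ := hρ
    have h1 : 1 + ρ ≠ 0 := by positivity
    have hexp : ContinuousAt (fun ρ : ℝ => 1 / (1 + ρ)) ρ :=
      continuousAt_const.div (by fun_prop) h1
    exact (ContinuousAt.comp (f := fun ρ : ℝ => 1 / (1 + ρ)) (g := fun s : ℝ => W x ^ s)
      (Real.continuousAt_const_rpow' (one_div_ne_zero h1)) hexp).continuousWithinAt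
  have hdist : ∀ x, ContinuousOn (fun ρ => tiltedDist W ρ x) (Set.Ici 0) := fun x =>
    (hpow x).div (continuousOn_finsetSum _ fun y _ => hpow y)
      fun ρ _ => (sum_rpow_pos hW0 hW1 _).ne'
  have hlog : Continuous fun t : ℝ => t * Real.logb d t := by
    simpa only [Real.logb, mul_div_assoc] using Real.continuous_mul_log.div_const (Real.log d)
  exact (continuousOn_finsetSum _ fun x _ => hlog.comp_continuousOn (hdist x)).neg

end TiltedDist

/-- Some tilted distribution meets complementary slackness for the rate constraint. -/
theorem exists_mul_eq_max_tiltedDist (d : ℕ) {X : Type*} [Fintype X] {W : X → ℝ}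
    (hW0 : ∀ x, 0 ≤ W x) (hW1 : ∑ x, W x = 1) (R : ℝ) :
    ∃ ρ ∈ Set.Icc (0 : ℝ) 1, ρ * (1 - entD d (tiltedDist W ρ) - R) =
      max (1 - entD d (tiltedDist W ρ) - R) 0 := by
  set g : ℝ → ℝ := fun ρ => 1 - entD d (tiltedDist W ρ) - R with hg
  have hcont : ContinuousOn g (Set.Icc 0 1) :=
    ((continuousOn_const.sub (continuousOn_entD_tiltedDist d hW0 hW1)).sub
      continuousOn_const).mono Set.Icc_subset_Ici_self
  by_cases h0 : g 0 ≤ 0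
  · exact ⟨0, by simp, by rw [zero_mul]; exact (max_eq_right h0).symm⟩
  by_cases h1 : 0 ≤ g 1
  · exact ⟨1, by simp, by rw [one_mul]; exact (max_eq_left h1).symm⟩
  obtain ⟨ρ, hρ, hgρ⟩ := intermediate_value_Icc' zero_le_one hcont
    ⟨(not_le.mp h1).le, (not_le.mp h0).le⟩
  refine ⟨ρ, hρ, ?_⟩
  change ρ * g ρ = max (g ρ) 0
  simp [hgρ]

theorem random_coding_exponent_gallager_form (d : ℕ) (hd : 2 ≤ d)
    (X : Type) [Fintype X] (hX : Fintype.card X = d ^ 2)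
    (W : X → ℝ) (hW0 : ∀ x, 0 ≤ W x) (hW1 : ∑ x, W x = 1)
    (R : ℝ) (hR : 0 ≤ R) :
    sInf {v : EReal | ∃ V : X → ℝ,
        (∀ x, 0 ≤ V x) ∧ (∑ x, V x) = 1 ∧
        v = divD d V W + ((max (1 - entD d V - R) 0 : ℝ) : EReal)} =
      sSup {v : EReal | ∃ ρ : ℝ, ρ ∈ Set.Icc (0 : ℝ) 1 ∧
        v = ((-ρ * R + E₀ d ρ W : ℝ) : EReal)} := by
  have hb : (1 : ℝ) < d := by exact_mod_cast hd
  apply le_antisymm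
  · obtain ⟨ρ, hρ, hslack⟩ := exists_mul_eq_max_tiltedDist d hW0 hW1 R
    have hac : ∀ x, W x = 0 → tiltedDist W ρ x = 0 := fun x => tiltedDist_eq_zero hρ.1
    refine sInf_le_of_le ⟨tiltedDist W ρ, tiltedDist_nonneg hW0, sum_tiltedDist hW0 hW1, rfl⟩
      (le_sSup ⟨ρ, hρ, ?_⟩)
    have hid := sum_mul_logb_div_sub_mul_entD d (tiltedDist_nonneg (ρ := ρ) hW0) hW0 hac hρ.1
    rw [sum_tiltedDist_mul_logb_div d hW0 hW1 hρ.1] at hid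
    rw [divD, if_pos hac, ← EReal.coe_add, ← hslack, E₀]
    congr 1
    linarith
  · refine sSup_le ?_
    rintro _ ⟨ρ, hρ, rfl⟩
    refine le_sInf ?_
    rintro _ ⟨V, hV0, hV1, rfl⟩
    rw [divD]
    split_ifs with hac
    · have h1 : 0 < 1 + ρ := by linarith [hρ.1]
      have hid := sum_mul_logb_div_sub_mul_entD d hV0 hW0 hac hρ.1
      have hgibbs := mul_le_mul_of_nonneg_left (neg_logb_sum_le_sum_mul_logb_div hb hV0 hV1
        (fun x => Real.rpow_nonneg (hW0 x) (1 / (1 + ρ)))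
        (fun x hx => hac x ((Real.rpow_eq_zero (hW0 x) (one_div_ne_zero h1.ne')).mp hx))
        (sum_rpow_pos hW0 hW1 _)) h1.le
      have hmax : ρ * (1 - entD d V - R) ≤ max (1 - entD d V - R) 0 :=
        (mul_le_mul_of_nonneg_left (le_max_left _ 0) hρ.1).trans
          (mul_le_of_le_one_left (le_max_right _ _) hρ.2)
      rw [← EReal.coe_add, EReal.coe_le_coe_iff, E₀]
      linarith
    · rw [EReal.top_add_coe]
      exact le_top
end

section
/- Let q ≥ 2 be an integer, X a finite set with |X| = q and a distinguished element 0, and r ∈ [0,1]. Then the minimum of Σ_{x ≠ 0} P(x) over all probability distributions P on X with H_q(P) ≥ 1 − r equals δ_GV(r), the unique solution t ∈ [0, (q−1)/q] of h_q(t) = 1 − r, where h_q(t) = t log_q(q−1) − t log_q t − (1−t) log_q(1−t). -/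
/-!
STATEMENT 10: `min { ∑_{x≠0} P(x) : H_q(P) ≥ 1 − r } = δ_GV(r)`, the inverse of the
`q`-ary entropy function `h_q` at `1 − r`.
-/

open scoped BigOperators

/-- Base-`q` entropy of a distribution on `X`. -/
noncomputable def entropyBase (q : ℕ) {X : Type*} [Fintype X] (P : X → ℝ) : ℝ :=
  -∑ x, P x * Real.logb q (P x)

/-- The `q`-ary entropy function
`h_q(t) = t log_q(q−1) − t log_q t − (1−t) log_q (1−t)`. -/
noncomputable def qaryEntropy (q : ℕ) (t : ℝ) : ℝ :=
  t * Real.logb q ((q : ℝ) - 1) - t * Real.logb q t - (1 - t) * Real.logb q (1 - t)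

theorem qaryEntropy_eq_div_log (q : ℕ) (t : ℝ) :
    qaryEntropy q t = Real.qaryEntropy q t / Real.log q := by
  simp only [qaryEntropy, Real.qaryEntropy, Real.binEntropy_eq_negMulLog_add_negMulLog_one_sub,
    Real.negMulLog, Real.logb]
  push_cast
  ring

theorem entropyBase_eq_sum_negMulLog_div_log (q : ℕ) {X : Type*} [Fintype X] (P : X → ℝ) :
    entropyBase q P = (∑ x, Real.negMulLog (P x)) / Real.log q := by
  simp only [entropyBase, Real.negMulLog, Real.logb, Finset.sum_div, ← Finset.sum_neg_distrib]
  exact Finset.sum_congr rfl fun x _ => by ring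

theorem mul_negMulLog_div {n : ℝ} (hn : n ≠ 0) (s : ℝ) :
    n * Real.negMulLog (s / n) = s * Real.log n + Real.negMulLog s := by
  rcases eq_or_ne s 0 with rfl | hs
  · simp
  · rw [Real.negMulLog, Real.negMulLog, Real.log_div hs hn]
    field_simp
    ring

theorem sum_negMulLog_le {ι : Type*} {S : Finset ι} (hS : S.Nonempty) {P : ι → ℝ}
    (hP : ∀ i ∈ S, 0 ≤ P i) :
    ∑ i ∈ S, Real.negMulLog (P i) ≤
      (∑ i ∈ S, P i) * Real.log S.card + Real.negMulLog (∑ i ∈ S, P i) := by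
  have hc : (0 : ℝ) < S.card := by exact_mod_cast hS.card_pos
  have h := Real.concaveOn_negMulLog.le_map_sum (t := S) (w := fun _ => (S.card : ℝ)⁻¹) (p := P)
    (fun _ _ => by positivity) (by simp [hc.ne']) hP
  simp only [smul_eq_mul, ← Finset.mul_sum] at h
  rw [← mul_negMulLog_div hc.ne', div_eq_inv_mul]
  calc ∑ i ∈ S, Real.negMulLog (P i)
      = S.card * ((S.card : ℝ)⁻¹ * ∑ i ∈ S, Real.negMulLog (P i)) := by field_simp
    _ ≤ _ := by gcongr

theorem card_filter_ne_add_one {X : Type*} [Fintype X] [DecidableEq X] (x₀ : X) :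
    (Finset.univ.filter (fun x => x ≠ x₀)).card + 1 = Fintype.card X := by
  rw [Finset.filter_ne', Finset.card_erase_add_one (Finset.mem_univ x₀), Finset.card_univ]

theorem sum_eq_add_sum_filter_ne {X : Type*} [Fintype X] [DecidableEq X] (x₀ : X) (f : X → ℝ) :
    ∑ x, f x = f x₀ + ∑ x ∈ Finset.univ.filter (fun x => x ≠ x₀), f x := by
  rw [Finset.filter_ne', Finset.add_sum_erase _ _ (Finset.mem_univ x₀)]

/-- Among distributions with a given mass off `x₀`, the entropy is largest when that mass is
spread uniformly. -/
theorem entropyBase_le_qaryEntropy {q : ℕ} (hq : 2 ≤ q) {X : Type*} [Fintype X] [DecidableEq X]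
    (hX : Fintype.card X = q) (x₀ : X) {P : X → ℝ} (hP : ∀ x, 0 ≤ P x) (hP1 : ∑ x, P x = 1) :
    entropyBase q P ≤ qaryEntropy q (∑ x ∈ Finset.univ.filter (fun x => x ≠ x₀), P x) := by
  have hcard := card_filter_ne_add_one x₀
  have hJ := sum_negMulLog_le (S := Finset.univ.filter (fun x => x ≠ x₀)) (P := P)
    (Finset.card_pos.1 (by omega)) fun x _ => hP x
  rw [sum_eq_add_sum_filter_ne x₀] at hP1
  have hc : ((Finset.univ.filter (fun x => x ≠ x₀)).card : ℝ) = q - 1 := by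
    rw [← hX, ← hcard]; push_cast; ring
  rw [qaryEntropy_eq_div_log, entropyBase_eq_sum_negMulLog_div_log, sum_eq_add_sum_filter_ne x₀,
    Real.qaryEntropy, Real.binEntropy_eq_negMulLog_add_negMulLog_one_sub, ← eq_sub_of_add_eq hP1]
  refine div_le_div_of_nonneg_right ?_ (Real.log_natCast_nonneg q)
  rw [hc] at hJ
  push_cast
  linarith

/-- The distribution with mass `1 - t` at `x₀` and mass `t` spread uniformly off `x₀`. -/
noncomputable def uniformOff {X : Type*} [Fintype X] [DecidableEq X] (x₀ : X) (t : ℝ) (x : X) : ℝ :=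
  if x = x₀ then 1 - t else t / (Fintype.card X - 1)

theorem sum_filter_ne_comp_uniformOff {X : Type*} [Fintype X] [DecidableEq X] (x₀ : X) (t : ℝ)
    (f : ℝ → ℝ) :
    ∑ x ∈ Finset.univ.filter (fun x => x ≠ x₀), f (uniformOff x₀ t x) =
      (Fintype.card X - 1) * f (t / (Fintype.card X - 1)) := by
  rw [Finset.sum_congr rfl (g := fun _ => f (t / (Fintype.card X - 1)))
    fun x hx => by rw [uniformOff, if_neg (Finset.mem_filter.1 hx).2]]
  rw [Finset.sum_const, nsmul_eq_mul, ← card_filter_ne_add_one x₀]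
  push_cast
  ring

theorem entropyBase_uniformOff {q : ℕ} (hq : 2 ≤ q) {X : Type*} [Fintype X] [DecidableEq X]
    (hX : Fintype.card X = q) (x₀ : X) (t : ℝ) :
    entropyBase q (uniformOff x₀ t) = qaryEntropy q t := by
  have hq' : (q : ℝ) - 1 ≠ 0 := by
    have : (2 : ℝ) ≤ q := by exact_mod_cast hq
    linarith
  rw [qaryEntropy_eq_div_log, entropyBase_eq_sum_negMulLog_div_log, sum_eq_add_sum_filter_ne x₀,
    sum_filter_ne_comp_uniformOff, hX, mul_negMulLog_div hq', Real.qaryEntropy,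
    Real.binEntropy_eq_negMulLog_add_negMulLog_one_sub, uniformOff, if_pos rfl]
  push_cast
  ring

theorem min_mass_off_zero_eq_gv (q : ℕ) (hq : 2 ≤ q)
    (X : Type) [Fintype X] [DecidableEq X] (hX : Fintype.card X = q) (x₀ : X)
    (r : ℝ) (hr : r ∈ Set.Icc (0 : ℝ) 1)
    (t : ℝ) (ht : t ∈ Set.Icc (0 : ℝ) (((q : ℝ) - 1) / q))
    (hth : qaryEntropy q t = 1 - r) :
    sInf {s : ℝ | ∃ P : X → ℝ,
        (∀ x, 0 ≤ P x) ∧ (∑ x, P x) = 1 ∧ 1 - r ≤ entropyBase q P ∧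
        s = ∑ x ∈ Finset.univ.filter (fun x => x ≠ x₀), P x} = t := by
  have hq2 : (2 : ℝ) ≤ q := by exact_mod_cast hq
  have hq0 : (0 : ℝ) < q := by linarith
  have hlog : 0 < Real.log q := Real.log_pos (by linarith)
  have hint : ((q : ℝ) - 1) / q = 1 - 1 / q := by field_simp
  rw [hint] at ht
  have ht1 : t ≤ 1 := ht.2.trans (sub_le_self _ (by positivity))
  have hoff := sum_filter_ne_comp_uniformOff x₀ t id
  simp only [id, hX] at hoff
  rw [mul_div_cancel₀ t (by linarith : (q : ℝ) - 1 ≠ 0)] at hoff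
  refine IsLeast.csInf_eq ⟨⟨uniformOff x₀ t, fun x => ?_, ?_, ?_, hoff.symm⟩, ?_⟩
  · rw [uniformOff, hX]
    split_ifs
    · linarith
    · exact div_nonneg ht.1 (by linarith)
  · rw [sum_eq_add_sum_filter_ne x₀, hoff, uniformOff, if_pos rfl]
    ring
  · rw [entropyBase_uniformOff hq hX, hth]
  · rintro s ⟨P, hP, hP1, hH, rfl⟩
    by_contra! hlt
    have hs := Finset.sum_nonneg fun x (_ : x ∈ Finset.univ.filter (fun x => x ≠ x₀)) => hP x
    have hmono := Real.qaryEntropy_strictMonoOn hq ⟨hs, hlt.le.trans ht.2⟩ ht hlt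
    have hle := hH.trans (entropyBase_le_qaryEntropy hq hX x₀ hP hP1)
    rw [← hth, qaryEntropy_eq_div_log, qaryEntropy_eq_div_log,
      div_le_div_iff_of_pos_right hlog] at hle
    linarith
end
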